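/- arXiv:2009.03150 — 2 statements merged into one kernel-verified Lean document; each statement's English description precedes it below -/
import Mathlib

section
/- Let m,n ≥ 1 and let G(B) be an m×n braced grid framework in the Euclidean plane (ℝ²,‖·‖₂). Then G(B) is infinitesimally rigid if and only if its braces graph is a connected spanning subgraph of the complete bipartite graph K_{m,n}. -/
open Asymptotics

abbrev V2 : Type := ℝ × ℝ

/-- The standard dot product on `ℝ × ℝ`. -/
def dot (v w : V2) : ℝ := v.1 * w.1 + v.2 * w.2

/-- The Euclidean norm on `ℝ × ℝ`. -/
noncomputable def eucNorm (v : V2) : ℝ := Real.sqrt (v.1 ^ 2 + v.2 ^ 2)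

/-- Rotation by `π/2`. -/
def rot90 (v : V2) : V2 := (-v.2, v.1)

/-- A bar-joint framework in the plane: a placement of joints and a set of bars. -/
structure Framework (J : Type) where
  pos : J → V2
  bars : Set (J × J)

/-- A Euclidean infinitesimal flex. -/
def IsEucFlex {J : Type} (F : Framework J) (u : J → V2) : Prop :=
  ∀ e ∈ F.bars, dot (u e.1 - u e.2) (F.pos e.1 - F.pos e.2) = 0

/-- A Euclidean rigid motion flex: `u i = c + θ • J (p i)`. -/
def IsRigidMotionFlex {J : Type} (F : Framework J) (u : J → V2) : Prop :=
  ∃ (c : V2) (θ : ℝ), ∀ i, u i = c + θ • rot90 (F.pos i)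

/-- Euclidean infinitesimal rigidity. -/
def EucRigid {J : Type} (F : Framework J) : Prop :=
  ∀ u, IsEucFlex F u → IsRigidMotionFlex F u

/-- An infinitesimal flex with respect to a general norm `ν`:
`ν (p i + t u i - (p j + t u j)) - ν (p i - p j) = o(t)` as `t → 0+`, for each bar. -/
def IsFlex (ν : V2 → ℝ) {J : Type} (F : Framework J) (u : J → V2) : Prop :=
  ∀ e ∈ F.bars,
    (fun t : ℝ =>
        ν (F.pos e.1 + t • u e.1 - (F.pos e.2 + t • u e.2)) - ν (F.pos e.1 - F.pos e.2))
      =o[nhdsWithin 0 (Set.Ioi 0)] (id : ℝ → ℝ)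

/-- Infinitesimal rigidity for a (non-Euclidean) norm: every flex is a translation,
i.e. a constant velocity field. -/
def NormRigid (ν : V2 → ℝ) {J : Type} (F : Framework J) : Prop :=
  ∀ u, IsFlex ν F u → ∀ i j, u i = u j

/-- `ν` is a norm on `ℝ²`. -/
def IsNormFn (ν : V2 → ℝ) : Prop :=
  (∀ v, ν v = 0 ↔ v = 0) ∧ (∀ (c : ℝ) (v : V2), ν (c • v) = |c| * ν v) ∧
    ∀ v w : V2, ν (v + w) ≤ ν v + ν w

/-- `ν` is differentiable (away from the origin). -/
def SmoothNorm (ν : V2 → ℝ) : Prop := ∀ v : V2, v ≠ 0 → DifferentiableAt ℝ ν v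

/-- `ν` is strictly convex. -/
def StrictlyConvexNorm (ν : V2 → ℝ) : Prop :=
  ∀ v w : V2, ν v = 1 → ν w = 1 → v ≠ w → ν ((1 / 2 : ℝ) • (v + w)) < 1

/-- `ν` is not a scalar multiple of the Euclidean norm. -/
def NonEuclidean (ν : V2 → ℝ) : Prop := ¬∃ c : ℝ, ∀ v, ν v = c * eucNorm v

/-- The point of the unit sphere of `ν` in the direction `θ`. -/
noncomputable def sphPt (ν : V2 → ℝ) (θ : ℝ) : V2 :=
  (ν (Real.cos θ, Real.sin θ))⁻¹ • ((Real.cos θ, Real.sin θ) : V2)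

/-- `w` is tangent to the unit sphere of `ν` at the point `q`. -/
def IsTangentAt (ν : V2 → ℝ) (q w : V2) : Prop := fderiv ℝ ν q w = 0

/-- The positively oriented unit tangent vector to the unit sphere of `ν`
at its point in the direction `θ`. -/
def IsPosUnitTangent (ν : V2 → ℝ) (θ : ℝ) (w : V2) : Prop :=
  ν w = 1 ∧ IsTangentAt ν (sphPt ν θ) w ∧
    0 < (sphPt ν θ).1 * w.2 - (sphPt ν θ).2 * w.1

/-- Rotation of the plane by the angle `α`. -/
noncomputable def rotv (α : ℝ) (v : V2) : V2 :=
  (v.1 * Real.cos α - v.2 * Real.sin α, v.1 * Real.sin α + v.2 * Real.cos α)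

/-- The joints of the `m × n` grid. -/
abbrev Joint (m n : ℕ) := Fin (m + 1) × Fin (n + 1)

/-- A brace: a square `(j,k)` together with a colour (`true` = blue diagonal
from `(j,k)` to `(j+1,k+1)`, `false` = red diagonal from `(j+1,k)` to `(j,k+1)`). -/
abbrev Brace (m n : ℕ) := Fin m × Fin n × Bool

/-- The bars of the unbraced `m × n` grid: unit horizontal and vertical segments. -/
def gridBars (m n : ℕ) : Set (Joint m n × Joint m n) :=
  {e | ((e.1.1 : ℕ) + 1 = (e.2.1 : ℕ) ∧ e.1.2 = e.2.2) ∨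
      (e.1.1 = e.2.1 ∧ (e.1.2 : ℕ) + 1 = (e.2.2 : ℕ))}

/-- The bar corresponding to a brace. -/
def braceBar {m n : ℕ} (b : Brace m n) : Joint m n × Joint m n :=
  if b.2.2 then ((b.1.castSucc, b.2.1.castSucc), (b.1.succ, b.2.1.succ))
  else ((b.1.succ, b.2.1.castSucc), (b.1.castSucc, b.2.1.succ))

/-- The axis-aligned braced `m × n` grid framework `G(B)`. -/
noncomputable def plainBracedGrid (m n : ℕ) (B : Set (Brace m n)) : Framework (Joint m n) where
  pos := fun v => ((v.1 : ℝ), (v.2 : ℝ))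
  bars := gridBars m n ∪ braceBar '' B

/-- The braced `m × n` grid framework `G(B)` of inclination `α`. -/
noncomputable def bracedGrid (m n : ℕ) (α : ℝ) (B : Set (Brace m n)) : Framework (Joint m n) where
  pos := fun v => rotv α ((v.1 : ℝ), (v.2 : ℝ))
  bars := gridBars m n ∪ braceBar '' B

/-- The braced `m × n` grid of `a × b` rectangles with inclination `α`. -/
noncomputable def bracedRectGrid (m n : ℕ) (a b α : ℝ) (B : Set (Brace m n)) :
    Framework (Joint m n) where
  pos := fun v => rotv α ((v.1 : ℝ) * a, (v.2 : ℝ) * b)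
  bars := gridBars m n ∪ braceBar '' B

/-- The unbraced axis-aligned `m × n` grid framework. -/
noncomputable def unbracedGrid (m n : ℕ) : Framework (Joint m n) where
  pos := fun v => ((v.1 : ℝ), (v.2 : ℝ))
  bars := gridBars m n

/-- The lines of the grid: `Sum.inl k` is the horizontal line at height `k`,
`Sum.inr j` is the vertical line at abscissa `j`. -/
abbrev LineIdx (m n : ℕ) := Fin (n + 1) ⊕ Fin (m + 1)

/-- The basis velocity field `u_l` supported on the joints of the line `l`. -/
def lineField (m n : ℕ) (l : LineIdx m n) : Joint m n → V2 := fun v =>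
  match l with
  | Sum.inl k => if v.2 = k then (1, 0) else (0, 0)
  | Sum.inr j => if v.1 = j then (0, 1) else (0, 0)

/-- The ribbons of the grid: `Sum.inl j` is the vertical ribbon `[j,j+1] × [0,n]`,
`Sum.inr k` is the horizontal ribbon `[0,m] × [k,k+1]`. -/
abbrev RibbonIdx (m n : ℕ) := Fin m ⊕ Fin n

/-- The sheer map on coefficient fields: `σ(u)(ρ) = d_{l₁} - d_{l₂}` for the boundary
lines `l₁` (right-hand, resp. lower) and `l₂` of the ribbon `ρ`. -/
def sheer {m n : ℕ} (d : LineIdx m n → ℝ) : RibbonIdx m n → ℝ := fun ρ =>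
  match ρ with
  | Sum.inl j => d (Sum.inr j.succ) - d (Sum.inr j.castSucc)
  | Sum.inr k => d (Sum.inl k.castSucc) - d (Sum.inl k.succ)

/-- The row of the Euclidean stress-sheer matrix indexed by a brace. -/
def eucSSRow {m n : ℕ} (b : Brace m n) : RibbonIdx m n → ℝ := fun ρ =>
  match ρ with
  | Sum.inl j => if j = b.1 then 1 else 0
  | Sum.inr k => if k = b.2.1 then -1 else 0

/-- The row of the Euclidean stress-sheer matrix of the fully braced grid
indexed by a square. -/
def eucSqRow {m n : ℕ} (s : Fin m × Fin n) : RibbonIdx m n → ℝ := fun ρ =>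
  match ρ with
  | Sum.inl j => if j = s.1 then 1 else 0
  | Sum.inr k => if k = s.2 then -1 else 0

/-- The row of the non-Euclidean stress-sheer matrix `SS_{λ,λ'}` indexed by a brace:
`+1` at the vertical ribbon, `-λ` (blue) or `-λ'` (red) at the horizontal ribbon. -/
def neRow {m n : ℕ} (lam lam' : ℝ) (b : Brace m n) : RibbonIdx m n → ℝ := fun ρ =>
  match ρ with
  | Sum.inl j => if j = b.1 then 1 else 0
  | Sum.inr k => if k = b.2.1 then (if b.2.2 then -lam else -lam') else 0

/-- Adjacency of rows (`Sum.inl`) and columns (`Sum.inr`) in the (bicoloured) braces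
graph with edge set `B`. -/
def bracesAdj {m n : ℕ} (B : Set (Brace m n)) (v w : Fin m ⊕ Fin n) : Prop :=
  ∃ e ∈ B, (v = Sum.inl e.1 ∧ w = Sum.inr e.2.1) ∨ (w = Sum.inl e.1 ∧ v = Sum.inr e.2.1)

/-- A (bicoloured) cycle of length `2(k+1)` in `K²_{m,n}`: rows `row 0, …, row k`,
columns `col 0, …, col k`, odd edges `e_{2i+1} = (row i, col i, c1 i)` and even edges
`e_{2i+2} = (row (i+1), col i, c2 i)` (cyclically); all `2(k+1)` edges are distinct. -/
structure BCycle (m n : ℕ) where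
  k : ℕ
  row : Fin (k + 1) → Fin m
  col : Fin (k + 1) → Fin n
  c1 : Fin (k + 1) → Bool
  c2 : Fin (k + 1) → Bool
  rowInj : Function.Injective row
  colInj : Function.Injective col
  nontriv : k = 0 → c1 ≠ c2

/-- The odd edges of a bicoloured cycle. -/
def BCycle.edge1 {m n : ℕ} (C : BCycle m n) (i : Fin (C.k + 1)) : Brace m n :=
  (C.row i, C.col i, C.c1 i)

/-- The even edges of a bicoloured cycle. -/
def BCycle.edge2 {m n : ℕ} (C : BCycle m n) (i : Fin (C.k + 1)) : Brace m n :=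
  (C.row (i + 1), C.col i, C.c2 i)

/-- The edge set of a bicoloured cycle. -/
def BCycle.edges {m n : ℕ} (C : BCycle m n) : Set (Brace m n) :=
  Set.range C.edge1 ∪ Set.range C.edge2

/-- Dependent colouring: the number of blue edges in odd position equals the number
of blue edges in even position. -/
def BCycle.DepColouring {m n : ℕ} (C : BCycle m n) : Prop :=
  (Finset.univ.filter fun i => C.c1 i = true).card =
    (Finset.univ.filter fun i => C.c2 i = true).card

/-- Linear independence of the set of rows of `SS_{λ,λ'}` indexed by `S`. -/
def RowsIndep (m n : ℕ) (lam lam' : ℝ) (S : Set (Brace m n)) : Prop :=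
  LinearIndependent ℝ fun e : S => neRow lam lam' (e : Brace m n)

/-- `S` is a circuit of the row matroid of `SS_{λ,λ'}`: a minimal dependent set of rows. -/
def IsCircuit (m n : ℕ) (lam lam' : ℝ) (S : Set (Brace m n)) : Prop :=
  ¬RowsIndep m n lam lam' S ∧ ∀ S' ⊂ S, RowsIndep m n lam lam' S'

/-- `S ⊆ K²_{m,n}` is a spanning independent cycle-rooted forest: every connected
component (of the multigraph with edge set `S` on the `m + n` vertices) has as many
edges as vertices, i.e. is a cycle-rooted tree (so in particular `S` is spanning),
and every cycle of edges in `S` has an independent colouring. -/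
def IsSpanningICRF (m n : ℕ) (S : Set (Brace m n)) : Prop :=
  (∀ v : Fin m ⊕ Fin n,
      {e ∈ S | Relation.ReflTransGen (bracesAdj S) v (Sum.inl e.1)}.ncard =
        {w | Relation.ReflTransGen (bracesAdj S) v w}.ncard) ∧
  ∀ C : BCycle m n, C.edges ⊆ S → ¬C.DepColouring

/-- The `p`-norm on the plane. -/
noncomputable def pNorm (p : ℝ) : V2 → ℝ := fun v => (|v.1| ^ p + |v.2| ^ p) ^ (1 / p)

/-- The sup norm on the plane. -/
noncomputable def supNorm : V2 → ℝ := fun v => max |v.1| |v.2|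

theorem isEucFlex_plainBracedGrid_iff {m n : ℕ} (B : Set (Brace m n)) (u : Joint m n → V2) :
    IsEucFlex (plainBracedGrid m n B) u ↔
      (∀ (j : Fin m) (k : Fin (n + 1)), (u (j.succ, k)).1 = (u (j.castSucc, k)).1) ∧
      (∀ (j : Fin (m + 1)) (k : Fin n), (u (j, k.succ)).2 = (u (j, k.castSucc)).2) ∧
      ∀ e ∈ B, dot (u (braceBar e).1 - u (braceBar e).2)
        ((plainBracedGrid m n B).pos (braceBar e).1 -
          (plainBracedGrid m n B).pos (braceBar e).2) = 0 := by
  constructor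
  · intro h
    refine ⟨fun j k => ?_, fun j k => ?_, fun e he => h _ (Or.inr ⟨e, he, rfl⟩)⟩
    · have := h ((j.castSucc, k), (j.succ, k)) (Or.inl (Or.inl ⟨by simp, rfl⟩))
      simp [dot, plainBracedGrid] at this
      linarith
    · have := h ((j, k.castSucc), (j, k.succ)) (Or.inl (Or.inr ⟨rfl, by simp⟩))
      simp [dot, plainBracedGrid] at this
      linarith
  · rintro ⟨hu₁, hu₂, hB⟩ e (he | ⟨b, hb, rfl⟩)
    · obtain ⟨⟨j, k⟩, ⟨j', k'⟩⟩ := e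
      rcases he with ⟨h₁, h₂⟩ | ⟨h₁, h₂⟩
      · dsimp only at h₁ h₂
        subst h₂
        have := hu₁ ⟨j, by omega⟩ k
        rw [show (⟨j, by omega⟩ : Fin m).succ = j' from Fin.ext h₁] at this
        simp [dot, plainBracedGrid, this]
      · dsimp only at h₁ h₂
        subst h₁
        have := hu₂ j ⟨k, by omega⟩
        rw [show (⟨k, by omega⟩ : Fin n).succ = k' from Fin.ext h₂] at this
        simp [dot, plainBracedGrid, this]
    · exact hB b hb

/-- For a field that is a flex of the unbraced grid, either diagonal of a square imposes the
equality of the shears of the two ribbons crossing at that square. -/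
theorem dot_braceBar_eq_zero_iff {m n : ℕ} (B : Set (Brace m n)) (a : Fin (n + 1) → ℝ)
    (b : Fin (m + 1) → ℝ) (e : Brace m n) :
    dot ((a (braceBar e).1.2, b (braceBar e).1.1) - (a (braceBar e).2.2, b (braceBar e).2.1))
        ((plainBracedGrid m n B).pos (braceBar e).1 -
          (plainBracedGrid m n B).pos (braceBar e).2) = 0 ↔
      b e.1.succ - b e.1.castSucc = a e.2.1.castSucc - a e.2.1.succ := by
  obtain ⟨j, k, c⟩ := e
  cases c <;> simp [dot, plainBracedGrid, braceBar] <;>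
    constructor <;> intro h <;> linarith

theorem eq_coord_of_isEucFlex {m n : ℕ} {B : Set (Brace m n)} {u : Joint m n → V2}
    (h : IsEucFlex (plainBracedGrid m n B) u) (v : Joint m n) :
    u v = ((u (0, v.2)).1, (u (v.1, 0)).2) := by
  obtain ⟨h₁, h₂, -⟩ := (isEucFlex_plainBracedGrid_iff B u).1 h
  obtain ⟨j, k⟩ := v
  refine Prod.ext ?_ ?_
  · induction j using Fin.induction with
    | zero => rfl
    | succ j ih => exact (h₁ j k).trans ih
  · induction k using Fin.induction with
    | zero => rfl
    | succ k ih => exact (h₂ j k).trans ih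

theorem eq_add_mul_of_succ_sub_castSucc {n : ℕ} {f : Fin (n + 1) → ℝ} {t : ℝ}
    (h : ∀ i : Fin n, f i.succ - f i.castSucc = t) (i : Fin (n + 1)) :
    f i = f 0 + t * (i : ℝ) := by
  induction i using Fin.induction with
  | zero => simp
  | succ i ih =>
    have := h i
    simp only [Fin.val_castSucc] at ih
    simp only [Fin.val_succ, Nat.cast_add, Nat.cast_one]
    linarith

theorem exists_succ_sub_castSucc_eq {n : ℕ} (s : Fin n → ℝ) :
    ∃ f : Fin (n + 1) → ℝ, ∀ i : Fin n, f i.succ - f i.castSucc = s i := by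
  refine ⟨fun j => ∑ i ∈ Finset.range j, if h : i < n then s ⟨i, h⟩ else 0, fun i => ?_⟩
  simp [Finset.sum_range_succ]

theorem bracesAdj_symm {m n : ℕ} {B : Set (Brace m n)} {v w : Fin m ⊕ Fin n}
    (h : bracesAdj B v w) : bracesAdj B w v := by
  obtain ⟨e, he, h⟩ := h
  exact ⟨e, he, h.symm⟩

theorem eucRigid_of_connected {m n : ℕ} (hm : 1 ≤ m) {B : Set (Brace m n)}
    (hB : ∀ v w : Fin m ⊕ Fin n, Relation.ReflTransGen (bracesAdj B) v w) :
    EucRigid (plainBracedGrid m n B) := by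
  intro u hu
  set a : Fin (n + 1) → ℝ := fun k => (u (0, k)).1
  set b : Fin (m + 1) → ℝ := fun j => (u (j, 0)).2
  have hab : ∀ v, u v = (a v.2, b v.1) := eq_coord_of_isEucFlex hu
  let s : Fin m ⊕ Fin n → ℝ :=
    Sum.elim (fun j => b j.succ - b j.castSucc) (fun k => a k.castSucc - a k.succ)
  have hs : ∀ v w, bracesAdj B v w → s v = s w := by
    have key : ∀ e ∈ B, s (Sum.inl e.1) = s (Sum.inr e.2.1) := fun e he => by
      have := ((isEucFlex_plainBracedGrid_iff B u).1 hu).2.2 e he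
      rw [hab, hab] at this
      exact (dot_braceBar_eq_zero_iff B a b e).1 this
    rintro v w ⟨e, he, ⟨rfl, rfl⟩ | ⟨rfl, rfl⟩⟩
    · exact key e he
    · exact (key e he).symm
  have hs' : ∀ v w, s v = s w := fun v w => by
    induction hB v w with
    | refl => rfl
    | tail _ h ih => exact ih.trans (hs _ _ h)
  set t := s (Sum.inl ⟨0, hm⟩)
  have hbt := eq_add_mul_of_succ_sub_castSucc (f := b) (t := t) fun j => hs' (Sum.inl j) _
  have hat := eq_add_mul_of_succ_sub_castSucc (f := a) (t := -t) fun k => by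
    have : a k.castSucc - a k.succ = t := hs' (Sum.inr k) _
    linarith
  refine ⟨(a 0, b 0), t, fun v => ?_⟩
  rw [hab, hat, hbt]
  simp [rot90, plainBracedGrid]

theorem connected_of_eucRigid {m n : ℕ} {B : Set (Brace m n)}
    (h : EucRigid (plainBracedGrid m n B)) (v w : Fin m ⊕ Fin n) :
    Relation.ReflTransGen (bracesAdj B) v w := by
  classical
  let s : Fin m ⊕ Fin n → ℝ := fun x => if Relation.ReflTransGen (bracesAdj B) v x then 1 else 0
  have hs : ∀ e ∈ B, s (Sum.inl e.1) = s (Sum.inr e.2.1) := fun e he => by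
    have hadj : bracesAdj B (Sum.inl e.1) (Sum.inr e.2.1) := ⟨e, he, Or.inl ⟨rfl, rfl⟩⟩
    exact if_congr ⟨fun h => h.tail hadj, fun h => h.tail (bracesAdj_symm hadj)⟩ rfl rfl
  obtain ⟨b, hb⟩ := exists_succ_sub_castSucc_eq fun j => s (Sum.inl j)
  obtain ⟨a, ha⟩ := exists_succ_sub_castSucc_eq fun k => -s (Sum.inr k)
  have hu : IsEucFlex (plainBracedGrid m n B) fun x => (a x.2, b x.1) := by
    refine (isEucFlex_plainBracedGrid_iff B _).2 ⟨fun _ _ => rfl, fun _ _ => rfl, fun e he => ?_⟩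
    refine (dot_braceBar_eq_zero_iff B a b e).2 ?_
    linarith [hb e.1, ha e.2.1, hs e he]
  obtain ⟨c, t, hct⟩ := h _ hu
  have ht : ∀ x, s x = t := by
    rintro (j | k)
    · have h₁ := congrArg Prod.snd (hct (j.succ, 0))
      have h₂ := congrArg Prod.snd (hct (j.castSucc, 0))
      simp [rot90, plainBracedGrid] at h₁ h₂
      linarith [hb j]
    · have h₁ := congrArg Prod.fst (hct (0, k.succ))
      have h₂ := congrArg Prod.fst (hct (0, k.castSucc))
      simp [rot90, plainBracedGrid] at h₁ h₂
      linarith [ha k]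
  have hv : s v = 1 := if_pos .refl
  by_contra hw
  have hw' : s w = 0 := if_neg hw
  linarith [ht v, ht w]

/-- Bolker–Crapo: a Euclidean braced `m × n` grid is infinitesimally
rigid iff its braces graph is a connected spanning subgraph of `K_{m,n}`, i.e. all
`m + n` vertices are joined to each other by paths of braces. -/
theorem statement1 (m n : ℕ) (hm : 1 ≤ m) (hn : 1 ≤ n) (B : Set (Brace m n)) :
    EucRigid (plainBracedGrid m n B) ↔
      ∀ v w : Fin m ⊕ Fin n, Relation.ReflTransGen (bracesAdj B) v w :=
  ⟨connected_of_eucRigid, eucRigid_of_connected hm⟩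
end

section
/- Let ‖·‖ be a differentiable, strictly convex norm on ℝ² that is not a scalar multiple of the Euclidean norm, and let α ∈ [0,π/2). Then the following are equivalent: (i) the doubly braced 1×1 square grid of inclination α is infinitesimally flexible in (ℝ²,‖·‖); (ii) the brace parameters λ, λ′ for ‖·‖ and α are equal; (iii) for every m,n ≥ 1, the maximally braced m×n square grid of inclination α is infinitesimally flexible in (ℝ²,‖·‖). -/
open Asymptotics

theorem IsNormFn.map_neg {ν : V2 → ℝ} (hν : IsNormFn ν) (v : V2) : ν (-v) = ν v := by
  simpa using hν.2.1 (-1) v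

theorem IsNormFn.ne_zero {ν : V2 → ℝ} (hν : IsNormFn ν) {v : V2} (hv : ν v = 1) : v ≠ 0 := by
  rintro rfl
  exact zero_ne_one (((hν.1 0).2 rfl).symm.trans hv)

theorem IsNormFn.pos {ν : V2 → ℝ} (hν : IsNormFn ν) {v : V2} (hv : v ≠ 0) : 0 < ν v := by
  have h := hν.2.2 v (-v)
  rw [add_neg_cancel, (hν.1 0).2 rfl, hν.map_neg] at h
  exact lt_of_le_of_ne (by linarith) fun h0 => hv ((hν.1 v).1 h0.symm)

/-- The derivative of a norm is positively homogeneous of degree zero, up to sign. -/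
theorem IsNormFn.fderiv_smul {ν : V2 → ℝ} (hν : IsNormFn ν) (hd : SmoothNorm ν) {v : V2}
    (hv : v ≠ 0) {c : ℝ} (hc : c ≠ 0) (w : V2) :
    c * fderiv ℝ ν (c • v) w = |c| * fderiv ℝ ν v w := by
  have h₁ : HasFDerivAt (fun x => ν (c • x))
      ((fderiv ℝ ν (c • v)).comp (c • ContinuousLinearMap.id ℝ V2)) v :=
    (hd _ (smul_ne_zero hc hv)).hasFDerivAt.comp v ((hasFDerivAt_id v).const_smul c)
  have h₂ : HasFDerivAt (fun x => ν (c • x)) (|c| • fderiv ℝ ν v) v := by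
    simp only [hν.2.1]
    exact (hd v hv).hasFDerivAt.const_mul |c|
  simpa using DFunLike.congr_fun (h₁.unique h₂) w

theorem isTangentAt_smul_iff {ν : V2 → ℝ} (hν : IsNormFn ν) (hd : SmoothNorm ν) {v : V2}
    (hv : v ≠ 0) {c : ℝ} (hc : c ≠ 0) (w : V2) :
    IsTangentAt ν (c • v) w ↔ IsTangentAt ν v w := by
  have h := hν.fderiv_smul hd hv hc w
  have hc' : |c| ≠ 0 := abs_ne_zero.2 hc
  unfold IsTangentAt
  constructor <;> intro h0 <;> simpa [h0, hc] using h

theorem isTangentAt_neg_neg_iff {ν : V2 → ℝ} (hν : IsNormFn ν) (hd : SmoothNorm ν) {v : V2}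
    (hv : v ≠ 0) (w : V2) : IsTangentAt ν (-v) (-w) ↔ IsTangentAt ν v w := by
  rw [← neg_one_smul ℝ v, isTangentAt_smul_iff hν hd hv (by norm_num)]
  simp [IsTangentAt]

theorem SmoothNorm.hasDerivAt_line {ν : V2 → ℝ} (hd : SmoothNorm ν) {v : V2} (hv : v ≠ 0)
    (w : V2) : HasDerivAt (fun t : ℝ => ν (v + t • w)) (fderiv ℝ ν v w) 0 := by
  have hl : HasDerivAt (fun t : ℝ => v + t • w) w 0 := by
    simpa using ((hasDerivAt_id (0 : ℝ)).smul_const w).const_add v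
  have hf : HasFDerivAt ν (fderiv ℝ ν v) (v + (0 : ℝ) • w) := by
    simpa using (hd v hv).hasFDerivAt
  exact hf.comp_hasDerivAt 0 hl

theorem IsNormFn.fderiv_self {ν : V2 → ℝ} (hν : IsNormFn ν) (hd : SmoothNorm ν) {v : V2}
    (hv : v ≠ 0) : fderiv ℝ ν v v = ν v := by
  refine (hd.hasDerivAt_line hv v).unique ?_
  have h : HasDerivAt (fun t : ℝ => (1 + t) * ν v) (ν v) 0 := by
    simpa using ((hasDerivAt_id (0 : ℝ)).const_add 1).mul_const (ν v)
  refine h.congr_of_eventuallyEq ?_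
  filter_upwards [lt_mem_nhds (show (-1 : ℝ) < 0 by norm_num)] with t ht
  rw [show v + t • v = (1 + t) • v by rw [add_smul, one_smul], hν.2.1,
    abs_of_pos (by linarith)]

theorem IsNormFn.fderiv_le {ν : V2 → ℝ} (hν : IsNormFn ν) (hd : SmoothNorm ν) {v : V2}
    (hv : v ≠ 0) (w : V2) : fderiv ℝ ν v w ≤ ν w := by
  refine le_of_tendsto (hd.hasDerivAt_line hv w).tendsto_slope_zero_right ?_
  filter_upwards [self_mem_nhdsWithin] with t (ht : 0 < t)
  have h := hν.2.2 v (t • w)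
  rw [hν.2.1, abs_of_pos ht] at h
  rw [zero_add, zero_smul, add_zero, smul_eq_mul, inv_mul_le_iff₀ ht]
  linarith

theorem IsNormFn.abs_fderiv_le {ν : V2 → ℝ} (hν : IsNormFn ν) (hd : SmoothNorm ν) {v : V2}
    (hv : v ≠ 0) (w : V2) : |fderiv ℝ ν v w| ≤ ν w := by
  have h := hν.fderiv_le hd hv (-w)
  rw [_root_.map_neg, hν.map_neg] at h
  exact abs_le.2 ⟨by linarith, hν.fderiv_le hd hv w⟩

/-- The flex condition on a bar is tangency of the relative velocity. -/
theorem isLittleO_bar_iff {ν : V2 → ℝ} (hd : SmoothNorm ν) {p q : V2} (hpq : p - q ≠ 0)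
    (a b : V2) :
    (fun t : ℝ => ν (p + t • a - (q + t • b)) - ν (p - q))
        =o[nhdsWithin 0 (Set.Ioi 0)] (id : ℝ → ℝ) ↔ IsTangentAt ν (p - q) (a - b) := by
  have hline := (hd.hasDerivAt_line hpq (a - b)).hasDerivWithinAt (s := Set.Ioi 0)
  have hzero : HasDerivWithinAt (fun t : ℝ => ν (p - q + t • (a - b))) 0 (Set.Ioi 0) 0 ↔
      (fun t : ℝ => ν (p + t • a - (q + t • b)) - ν (p - q))
        =o[nhdsWithin 0 (Set.Ioi 0)] (id : ℝ → ℝ) := by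
    rw [hasDerivWithinAt_iff_isLittleO]
    have h (t : ℝ) : p + t • a - (q + t • b) = p - q + t • (a - b) := by module
    simp only [h, smul_zero, sub_zero, zero_smul, add_zero]
    rfl
  rw [← hzero, IsTangentAt]
  constructor
  · exact fun h => (uniqueDiffWithinAt_Ioi (0 : ℝ)).eq_deriv _ hline h
  · exact fun h => h ▸ hline

/-- The kernel of a nonzero functional on the plane is spanned by any of its nonzero elements. -/
theorem exists_eq_smul_of_apply_eq_zero (f : V2 →L[ℝ] ℝ) {p z w : V2} (hp : f p ≠ 0)
    (hz0 : z ≠ 0) (hz : f z = 0) (hw : f w = 0) : ∃ a : ℝ, w = a • z := by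
  have key (x : V2) : f x = x.1 * f (1, 0) + x.2 * f (0, 1) := by
    conv_lhs => rw [show x = x.1 • ((1, 0) : V2) + x.2 • ((0, 1) : V2) by ext <;> simp]
    rw [map_add, map_smul, map_smul, smul_eq_mul, smul_eq_mul]
  rw [key] at hp hz hw
  set A := f (1, 0)
  set B := f (0, 1)
  have hcross : w.1 * z.2 - w.2 * z.1 = 0 := by
    have hA : A * (w.1 * z.2 - w.2 * z.1) = 0 := by linear_combination z.2 * hw - w.2 * hz
    have hB : B * (w.1 * z.2 - w.2 * z.1) = 0 := by linear_combination w.1 * hz - z.1 * hw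
    by_contra h
    exact hp (by simp [(mul_eq_zero.1 hA).resolve_right h, (mul_eq_zero.1 hB).resolve_right h])
  by_cases h1 : z.1 = 0
  · have h2 : z.2 ≠ 0 := fun h2 => hz0 (Prod.ext h1 h2)
    refine ⟨w.2 / z.2, Prod.ext ?_ ?_⟩ <;> simp <;> field_simp
    linear_combination hcross
  · refine ⟨w.1 / z.1, Prod.ext ?_ ?_⟩ <;> simp <;> field_simp
    linear_combination -hcross

/-- For a strictly convex norm, tangent lines at points of distinct directions are not parallel. -/
theorem eq_zero_of_isTangentAt_of_isTangentAt {ν : V2 → ℝ} (hν : IsNormFn ν)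
    (hd : SmoothNorm ν) (hc : StrictlyConvexNorm ν) {p q z : V2} (hp : ν p = 1) (hq : ν q = 1)
    (hpq : p ≠ q) (hpq' : p ≠ -q) (hzp : IsTangentAt ν p z) (hzq : IsTangentAt ν q z) :
    z = 0 := by
  by_contra hz
  have hpp : fderiv ℝ ν p p = 1 := (hν.fderiv_self hd (hν.ne_zero hp)).trans hp
  have hqq : fderiv ℝ ν q q = 1 := (hν.fderiv_self hd (hν.ne_zero hq)).trans hq
  have aligned {x : V2} (hx : ν x = 1) (hpx : p ≠ x) : fderiv ℝ ν p x ≠ 1 := fun h => by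
    have h1 := hν.fderiv_le hd (hν.ne_zero hp) ((1 / 2 : ℝ) • (p + x))
    rw [map_smul, map_add, hpp, h, smul_eq_mul] at h1
    linarith [hc p x hp hx hpx]
  set s := fderiv ℝ ν p q with hs
  obtain ⟨k, hk⟩ := exists_eq_smul_of_apply_eq_zero (fderiv ℝ ν p) (w := q - s • p)
    (hpp ▸ one_ne_zero) hz hzp (by simp [hpp, hs])
  have hmul : s * fderiv ℝ ν q p = 1 := by
    have := congrArg (fderiv ℝ ν q) hk
    rw [map_sub, map_smul, map_smul, hqq, hzq, smul_eq_mul, smul_zero] at this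
    linarith
  have hs1 : |s| ≤ 1 := hq ▸ hν.abs_fderiv_le hd (hν.ne_zero hp) q
  have hr1 : |fderiv ℝ ν q p| ≤ 1 := hp ▸ hν.abs_fderiv_le hd (hν.ne_zero hq) p
  have habs : |s| = 1 := by
    have h := congrArg abs hmul
    rw [abs_mul, abs_one] at h
    nlinarith [abs_nonneg s]
  rcases eq_or_eq_neg_of_abs_eq habs with h | h
  · exact aligned hq hpq h
  · exact aligned ((hν.map_neg q).trans hq) hpq' (by rw [_root_.map_neg, ← hs, h, neg_neg])

theorem rotv_ne_zero (α : ℝ) {v : V2} (hv : v ≠ 0) : rotv α v ≠ 0 := by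
  intro h
  have h1 := congrArg Prod.fst h
  have h2 := congrArg Prod.snd h
  simp only [rotv, Prod.fst_zero, Prod.snd_zero] at h1 h2
  refine hv (Prod.ext ?_ ?_)
  · rw [Prod.fst_zero]
    linear_combination Real.cos α * h1 + Real.sin α * h2 - v.1 * Real.sin_sq_add_cos_sq α
  · rw [Prod.snd_zero]
    linear_combination Real.cos α * h2 - Real.sin α * h1 - v.2 * Real.sin_sq_add_cos_sq α

theorem rotv_sub (α : ℝ) (v w : V2) : rotv α v - rotv α w = rotv α (v - w) := by
  ext <;> simp [rotv] <;> ring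

theorem rotv_neg (α : ℝ) (v : V2) : rotv α (-v) = -rotv α v := by
  ext <;> simp [rotv] <;> ring

theorem cos_sin_ne_zero (θ : ℝ) : ((Real.cos θ, Real.sin θ) : V2) ≠ 0 := fun h => by
  have h1 := congrArg Prod.fst h
  have h2 := congrArg Prod.snd h
  simp only [Prod.fst_zero, Prod.snd_zero] at h1 h2
  simpa [h1, h2] using Real.sin_sq_add_cos_sq θ

/-- Tangency at the sphere point of direction `θ` may be tested at any point of that line. -/
theorem isTangentAt_sphPt_iff {ν : V2 → ℝ} (hν : IsNormFn ν) (hd : SmoothNorm ν) {θ c : ℝ}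
    (hc : c ≠ 0) {d : V2} (h : ((Real.cos θ, Real.sin θ) : V2) = c • d) (w : V2) :
    IsTangentAt ν (sphPt ν θ) w ↔ IsTangentAt ν d w := by
  have hdir := cos_sin_ne_zero θ
  have hd0 : d ≠ 0 := fun h0 => hdir (by rw [h, h0, smul_zero])
  rw [sphPt, isTangentAt_smul_iff hν hd hdir (inv_ne_zero (hν.pos hdir).ne'), h,
    isTangentAt_smul_iff hν hd hd0 hc]

theorem IsNormFn.apply_sphPt {ν : V2 → ℝ} (hν : IsNormFn ν) (θ : ℝ) : ν (sphPt ν θ) = 1 := by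
  have hdir := cos_sin_ne_zero θ
  have h := hν.pos hdir
  rw [sphPt, hν.2.1, abs_of_pos (inv_pos.2 h), inv_mul_cancel₀ h.ne']

theorem isTangentAt_rotv_bar_iff {ν : V2 → ℝ} (hν : IsNormFn ν) (hd : SmoothNorm ν) (α : ℝ)
    {p q d : V2} (hd0 : d ≠ 0) (h : q - p = d) (a b : V2) :
    (fun t : ℝ => ν (rotv α p + t • a - (rotv α q + t • b)) - ν (rotv α p - rotv α q))
        =o[nhdsWithin 0 (Set.Ioi 0)] (id : ℝ → ℝ) ↔ IsTangentAt ν (rotv α d) (b - a) := by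
  have hne := rotv_ne_zero α hd0
  have hpq : rotv α p - rotv α q = -rotv α d := by rw [rotv_sub, ← neg_sub q p, h, rotv_neg]
  rw [isLittleO_bar_iff hd (hpq ▸ neg_ne_zero.2 hne), hpq, ← neg_sub b a,
    isTangentAt_neg_neg_iff hν hd hne]

/-- The flexes of the maximally braced grid, bar by bar. -/
theorem isFlex_bracedGrid_univ_iff {ν : V2 → ℝ} (hν : IsNormFn ν) (hd : SmoothNorm ν) (m n : ℕ)
    (α : ℝ) (u : Joint m n → V2) :
    IsFlex ν (bracedGrid m n α Set.univ) u ↔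
      (∀ (j : Fin m) (k : Fin (n + 1)),
        IsTangentAt ν (rotv α (1, 0)) (u (j.succ, k) - u (j.castSucc, k))) ∧
      (∀ (j : Fin (m + 1)) (k : Fin n),
        IsTangentAt ν (rotv α (0, 1)) (u (j, k.succ) - u (j, k.castSucc))) ∧
      (∀ (j : Fin m) (k : Fin n),
        IsTangentAt ν (rotv α (1, 1)) (u (j.succ, k.succ) - u (j.castSucc, k.castSucc))) ∧
      (∀ (j : Fin m) (k : Fin n),
        IsTangentAt ν (rotv α (-1, 1)) (u (j.castSucc, k.succ) - u (j.succ, k.castSucc))) := by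
  have bar (e : Joint m n × Joint m n) (d : V2) (hd0 : d ≠ 0)
      (h : (((e.2.1 : ℝ), (e.2.2 : ℝ)) : V2) - ((e.1.1 : ℝ), (e.1.2 : ℝ)) = d) :=
    isTangentAt_rotv_bar_iff hν hd α hd0 h (u e.1) (u e.2)
  constructor
  · intro hu
    refine ⟨fun j k => ?_, fun j k => ?_, fun j k => ?_, fun j k => ?_⟩
    · exact (bar ((j.castSucc, k), (j.succ, k)) (1, 0) (by simp) (by simp)).1
        (hu _ (Or.inl (Or.inl ⟨by simp, rfl⟩)))
    · exact (bar ((j, k.castSucc), (j, k.succ)) (0, 1) (by simp) (by simp)).1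
        (hu _ (Or.inl (Or.inr ⟨rfl, by simp⟩)))
    · exact (bar ((j.castSucc, k.castSucc), (j.succ, k.succ)) (1, 1) (by simp) (by simp)).1
        (hu _ (Or.inr ⟨(j, k, true), trivial, rfl⟩))
    · exact (bar ((j.succ, k.castSucc), (j.castSucc, k.succ)) (-1, 1) (by simp) (by simp)).1
        (hu _ (Or.inr ⟨(j, k, false), trivial, rfl⟩))
  · rintro ⟨hX, hY, hB, hR⟩ e (he | ⟨⟨j, k, c⟩, -, rfl⟩)
    · obtain ⟨⟨a, b⟩, a', b'⟩ := e
      rcases he with ⟨h1, h2⟩ | ⟨h1, h2⟩ <;> simp only at h1 h2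
      · subst h2
        obtain ⟨j, rfl⟩ : ∃ j : Fin m, j.castSucc = a := ⟨⟨a, by omega⟩, rfl⟩
        obtain rfl : j.succ = a' := Fin.ext (by simpa using h1)
        exact (bar _ (1, 0) (by simp) (by simp)).2 (hX j b)
      · subst h1
        obtain ⟨k, rfl⟩ : ∃ k : Fin n, k.castSucc = b := ⟨⟨b, by omega⟩, rfl⟩
        obtain rfl : k.succ = b' := Fin.ext (by simpa using h2)
        exact (bar _ (0, 1) (by simp) (by simp)).2 (hY a k)
    · cases c
      · exact (bar (braceBar (j, k, false)) (-1, 1) (by simp) (by simp [braceBar])).2 (hR j k)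
      · exact (bar (braceBar (j, k, true)) (1, 1) (by simp) (by simp [braceBar])).2 (hB j k)

/-- The unit tangent vectors at perpendicular directions are linearly independent. -/
theorem eq_zero_of_smul_add_smul_eq_zero {ν : V2 → ℝ} (hν : IsNormFn ν) (hd : SmoothNorm ν)
    (hc : StrictlyConvexNorm ν) {α : ℝ} {ux uy : V2} (hux : IsPosUnitTangent ν α ux)
    (huy : IsPosUnitTangent ν (α + Real.pi / 2) uy) {a b : ℝ} (h : a • ux + b • uy = 0) :
    a = 0 ∧ b = 0 := by
  have ha : a = 0 := by
    by_contra ha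
    have hpar : ux = (-(a⁻¹ * b)) • uy := by
      have h' : a⁻¹ • (a • ux + b • uy) = 0 := by rw [h, smul_zero]
      rw [smul_add, inv_smul_smul₀ ha, smul_smul] at h'
      rw [neg_smul]
      exact eq_neg_of_add_eq_zero_left h'
    have hdot : dot (sphPt ν α) (sphPt ν (α + Real.pi / 2)) = 0 := by
      simp [dot, sphPt, Real.cos_add_pi_div_two, Real.sin_add_pi_div_two]
      ring
    have hself {v : V2} (hv : dot v v = 0) : v = 0 := by
      unfold dot at hv
      exact Prod.ext (by simpa using (mul_self_add_mul_self_eq_zero.1 hv).1)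
        (by simpa using (mul_self_add_mul_self_eq_zero.1 hv).2)
    have hp1 := hν.apply_sphPt α
    refine (hν.ne_zero hux.1) (eq_zero_of_isTangentAt_of_isTangentAt hν hd hc hp1
      (hν.apply_sphPt (α + Real.pi / 2)) (fun h => ?_) (fun h => ?_) hux.2.1 ?_)
    · exact hν.ne_zero hp1 (hself (by rwa [← h] at hdot))
    · refine hν.ne_zero hp1 (hself ?_)
      rw [eq_neg_iff_add_eq_zero, add_comm, ← eq_neg_iff_add_eq_zero] at h
      rw [h] at hdot
      simp only [dot, Prod.fst_neg, Prod.snd_neg] at hdot ⊢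
      linarith
    · have := huy.2.1
      rw [IsTangentAt] at this ⊢
      rw [hpar, map_smul, this, smul_zero]
  refine ⟨ha, ?_⟩
  rw [ha, zero_smul, zero_add] at h
  exact (smul_eq_zero.1 h).resolve_right (hν.ne_zero huy.1)

/-- Lemma 3.1: for a differentiable, strictly convex, non-Euclidean norm
and inclination `α`, with brace parameters `λ`, `λ'`, the following are equivalent:
(i) the doubly braced `1 × 1` square grid of inclination `α` is infinitesimally flexible;
(ii) `λ = λ'`;
(iii) every maximally braced `m × n` square grid of inclination `α` is infinitesimally
flexible. -/
theorem statement9 (ν : V2 → ℝ) (hnorm : IsNormFn ν) (hdiff : SmoothNorm ν)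
    (hconv : StrictlyConvexNorm ν) (hne : NonEuclidean ν)
    (α : ℝ) (hα0 : 0 ≤ α) (hα1 : α < Real.pi / 2) (ux uy : V2)
    (hux : IsPosUnitTangent ν α ux) (huy : IsPosUnitTangent ν (α + Real.pi / 2) uy)
    (lam lam' : ℝ) (hlam : 0 < lam) (hlam' : 0 < lam')
    (htb : IsTangentAt ν (sphPt ν (α + Real.pi / 4)) (lam • ux + uy))
    (htb' : IsTangentAt ν (sphPt ν (α + 3 * Real.pi / 4)) (-lam' • ux + uy)) :
    List.TFAE
      [¬NormRigid ν (bracedGrid 1 1 α Set.univ),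
       lam = lam',
       ∀ m n : ℕ, 1 ≤ m → 1 ≤ n → ¬NormRigid ν (bracedGrid m n α Set.univ)] := by
  have dirX : ((Real.cos α, Real.sin α) : V2) = (1 : ℝ) • rotv α (1, 0) := by
    simp [rotv]
  have dirY : ((Real.cos (α + Real.pi / 2), Real.sin (α + Real.pi / 2)) : V2) =
      (1 : ℝ) • rotv α (0, 1) := by
    simp [rotv, Real.cos_add_pi_div_two, Real.sin_add_pi_div_two]
  have dirB : ((Real.cos (α + Real.pi / 4), Real.sin (α + Real.pi / 4)) : V2) =
      (Real.sqrt 2 / 2) • rotv α (1, 1) := by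
    ext <;> simp [rotv, Real.cos_add, Real.sin_add] <;> ring
  have dirR : ((Real.cos (α + 3 * Real.pi / 4), Real.sin (α + 3 * Real.pi / 4)) : V2) =
      (Real.sqrt 2 / 2) • rotv α (-1, 1) := by
    rw [show α + 3 * Real.pi / 4 = α + Real.pi / 4 + Real.pi / 2 by ring,
      Real.cos_add_pi_div_two, Real.sin_add_pi_div_two]
    ext <;> simp [rotv, Real.cos_add, Real.sin_add] <;> ring
  have hsqrt : Real.sqrt 2 / 2 ≠ 0 := by positivity
  have hX := (isTangentAt_sphPt_iff hnorm hdiff one_ne_zero dirX ux).1 hux.2.1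
  have hY := (isTangentAt_sphPt_iff hnorm hdiff one_ne_zero dirY uy).1 huy.2.1
  have hB := (isTangentAt_sphPt_iff hnorm hdiff hsqrt dirB _).1 htb
  have hR := (isTangentAt_sphPt_iff hnorm hdiff hsqrt dirR _).1 htb'
  have hux0 : ux ≠ 0 := hnorm.ne_zero hux.1
  have huy0 : uy ≠ 0 := hnorm.ne_zero huy.1
  tfae_have 3 → 1 := fun h => h 1 1 le_rfl le_rfl
  tfae_have 2 → 3 := by
    rintro rfl m n hm hn hrigid
    have hflex : IsFlex ν (bracedGrid m n α Set.univ)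
        (fun v => ((v.1 : ℝ) * lam) • ux + (v.2 : ℝ) • uy) := by
      refine (isFlex_bracedGrid_univ_iff hnorm hdiff m n α _).2
        ⟨fun j k => ?_, fun j k => ?_, fun j k => ?_, fun j k => ?_⟩
      · convert (show IsTangentAt ν (rotv α (1, 0)) (lam • ux) by
          rw [IsTangentAt] at hX ⊢; simp [hX]) using 1
        push_cast [Fin.val_succ, Fin.val_castSucc]
        module
      · convert hY using 1
        push_cast [Fin.val_succ, Fin.val_castSucc]
        module
      · convert hB using 1
        push_cast [Fin.val_succ, Fin.val_castSucc]
        module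
      · convert hR using 1
        push_cast [Fin.val_succ, Fin.val_castSucc]
        module
    have h := hrigid _ hflex ((0 : Fin m.succ), 0) (⟨1, by omega⟩, 0)
    have h' : lam • ux = 0 := by simpa using h.symm
    exact smul_ne_zero hlam.ne' hux0 h'
  tfae_have 1 → 2 := by
    intro hflexible
    rw [NormRigid] at hflexible
    push Not at hflexible
    obtain ⟨u, hu, i, i', hne'⟩ := hflexible
    obtain ⟨tX, tY, tB, tR⟩ := (isFlex_bracedGrid_univ_iff hnorm hdiff 1 1 α u).1 hu
    have indep (a b : ℝ) (h : a • ux + b • uy = 0) : a = 0 ∧ b = 0 :=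
      eq_zero_of_smul_add_smul_eq_zero hnorm hdiff hconv hux huy h
    have span {d z w : V2} (hd0 : d ≠ 0) (hz0 : z ≠ 0) (hz : IsTangentAt ν (rotv α d) z)
        (hw : IsTangentAt ν (rotv α d) w) : ∃ a : ℝ, w = a • z := by
      have hr := rotv_ne_zero α hd0
      exact exists_eq_smul_of_apply_eq_zero (fderiv ℝ ν (rotv α d)) (p := rotv α d)
        (by rw [hnorm.fderiv_self hdiff hr]; exact (hnorm.pos hr).ne') hz0 hz hw
    obtain ⟨a, ha⟩ := span (by simp) hux0 hX (tX 0 0)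
    obtain ⟨b, hb⟩ := span (by simp) hux0 hX (tX 0 1)
    obtain ⟨c, hc⟩ := span (by simp) huy0 hY (tY 0 0)
    obtain ⟨d, hd⟩ := span (by simp) huy0 hY (tY 1 0)
    obtain ⟨r, hr⟩ := span (by simp) (fun h => one_ne_zero (indep lam 1 (by simpa using h)).2)
      hB (tB 0 0)
    obtain ⟨s, hs⟩ := span (by simp) (fun h => one_ne_zero (indep (-lam') 1 (by simpa using h)).2)
      hR (tR 0 0)
    simp only [Fin.succ_zero_eq_one, Fin.castSucc_zero, Nat.reduceAdd] at ha hb hc hd hr hs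
    have hpar := indep (a - b) (d - c) (by
      linear_combination (norm := module) -ha + hb - hd + hc)
    have hblue := indep (a - r * lam) (d - r) (by
      linear_combination (norm := module) hr - ha - hd)
    have hred := indep (-a + s * lam') (c - s) (by
      linear_combination (norm := module) hs + ha - hc)
    have hc0 : c ≠ 0 := fun h0 => by
      have ha0 : a = 0 := by
        have := hred.1; rw [show s = 0 by linarith [hred.2]] at this; linarith
      have hb0 : b = 0 := by linarith [hpar.1]
      rw [ha0, zero_smul, sub_eq_zero] at ha
      rw [hb0, zero_smul, sub_eq_zero] at hb
      rw [h0, zero_smul, sub_eq_zero] at hc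
      have hconst (x : Joint 1 1) : u x = u (0, 0) := by
        obtain ⟨x, y⟩ := x
        fin_cases x <;> fin_cases y <;> simp [ha, hb, hc]
      exact hne' ((hconst i).trans (hconst i').symm)
    have hrc : r = c := by linarith [hpar.2, hblue.2]
    have hsc : s = c := by linarith [hred.2]
    rw [hrc] at hblue
    rw [hsc] at hred
    exact mul_left_cancel₀ hc0 (by linarith [hblue.1, hred.1])
  tfae_finish
end
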